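/- Fix n ∈ ℕ and λ, μ ∈ ℝ, and let 𝔤 be the (2n+5)-dimensional real Lie algebra with basis {A, w₁, w₂, z₁, z₂, x₁, y₁, …, xₙ, yₙ}, B := z₂ − A, and nonzero brackets [A,w₁] = z₂, [A,w₂] = −z₁, [z₁,w₁] = z₁, [z₁,w₂] = z₂ − 2B, [z₂,w₁] = z₂ + 2B, [z₂,w₂] = −z₁, [w₁,w₂] = (μ−λ)B − μz₂, [xₐ,y_b] = −2δ_{ab}B, [w₁,xₐ] = −xₐ, [w₁,yₐ] = −yₐ, [w₂,xₐ] = −yₐ, [w₂,yₐ] = xₐ. Then the subspace 𝔫 = span{A, z₁, z₂, x₁, y₁, …, xₙ, yₙ} is an ideal of 𝔤 which is nilpotent of class at most 2 (that is, [𝔫,[𝔫,𝔫]] = 0, with [𝔫,𝔫] ⊆ ℝB), and the quotient Lie algebra 𝔤/𝔫 is abelian of dimension 2. -/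

import Mathlib

/-!
The Lie algebra 𝔤 ≅ 𝔲(1) ⊕ ℂ² ⊕ ℂⁿ of infinitesimal isometries associated to a
strongly degenerate homogeneous pseudo-Kähler structure of linear type.

Basis convention on `LieBas n = Fin 5 ⊕ Fin n × Fin 2`:
`Sum.inl 0 = A`, `Sum.inl 1 = w₁`, `Sum.inl 2 = w₂`, `Sum.inl 3 = z₁`,
`Sum.inl 4 = z₂`, `Sum.inr (a, 0) = xₐ`, `Sum.inr (a, 1) = yₐ`;
the underlying vector space is `LieG n = LieBas n → ℝ` and `Bv = z₂ − A`.
-/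

abbrev LieBas (n : ℕ) := Fin 5 ⊕ Fin n × Fin 2

abbrev LieG (n : ℕ) := LieBas n → ℝ

noncomputable def bas (n : ℕ) (i : LieBas n) : LieG n := Pi.single i 1

noncomputable def Bv (n : ℕ) : LieG n := bas n (.inl 4) - bas n (.inl 0)

/-- Brackets of basis elements. -/
noncomputable def cb (n : ℕ) (lam mu : ℝ) : LieBas n → LieBas n → LieG n
  | .inl 0, .inl 1 => bas n (.inl 4)
  | .inl 1, .inl 0 => -bas n (.inl 4)
  | .inl 0, .inl 2 => -bas n (.inl 3)
  | .inl 2, .inl 0 => bas n (.inl 3)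
  | .inl 3, .inl 1 => bas n (.inl 3)
  | .inl 1, .inl 3 => -bas n (.inl 3)
  | .inl 3, .inl 2 => bas n (.inl 4) - (2 : ℝ) • Bv n
  | .inl 2, .inl 3 => -(bas n (.inl 4) - (2 : ℝ) • Bv n)
  | .inl 4, .inl 1 => bas n (.inl 4) + (2 : ℝ) • Bv n
  | .inl 1, .inl 4 => -(bas n (.inl 4) + (2 : ℝ) • Bv n)
  | .inl 4, .inl 2 => -bas n (.inl 3)
  | .inl 2, .inl 4 => bas n (.inl 3)
  | .inl 1, .inl 2 => (mu - lam) • Bv n - mu • bas n (.inl 4)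
  | .inl 2, .inl 1 => -((mu - lam) • Bv n - mu • bas n (.inl 4))
  | .inr (a, 0), .inr (b, 1) => if a = b then (-2 : ℝ) • Bv n else 0
  | .inr (a, 1), .inr (b, 0) => if a = b then (2 : ℝ) • Bv n else 0
  | .inl 1, .inr (a, 0) => -bas n (.inr (a, 0))
  | .inr (a, 0), .inl 1 => bas n (.inr (a, 0))
  | .inl 1, .inr (a, 1) => -bas n (.inr (a, 1))
  | .inr (a, 1), .inl 1 => bas n (.inr (a, 1))
  | .inl 2, .inr (a, 0) => -bas n (.inr (a, 1))
  | .inr (a, 0), .inl 2 => bas n (.inr (a, 1))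
  | .inl 2, .inr (a, 1) => bas n (.inr (a, 0))
  | .inr (a, 1), .inl 2 => -bas n (.inr (a, 0))
  | _, _ => 0

/-- The bilinear extension of the bracket of basis elements. -/
noncomputable def br (n : ℕ) (lam mu : ℝ) (f g : LieG n) : LieG n :=
  ∑ i : LieBas n, ∑ j : LieBas n, (f i * g j) • cb n lam mu i j

/-- 𝔫 = span{A, z₁, z₂, x₁, y₁, …, xₙ, yₙ}. -/
noncomputable def nilSpan (n : ℕ) : Submodule ℝ (LieG n) :=
  Submodule.span ℝ
    {v : LieG n | ∃ i : LieBas n, i ≠ Sum.inl 1 ∧ i ≠ Sum.inl 2 ∧ v = bas n i}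

theorem mem_nilSpan_iff {n : ℕ} {v : LieG n} :
    v ∈ nilSpan n ↔ v (.inl 1) = 0 ∧ v (.inl 2) = 0 := by
  constructor
  · intro hv
    induction hv using Submodule.span_induction with
    | mem x hx =>
      obtain ⟨i, h1, h2, rfl⟩ := hx
      exact ⟨Pi.single_eq_of_ne h1.symm _, Pi.single_eq_of_ne h2.symm _⟩
    | zero => simp
    | add x y _ _ hx hy => simp [hx, hy]
    | smul c x _ hx => simp [hx]
  · rintro ⟨h1, h2⟩
    rw [pi_eq_sum_univ' v]
    refine Submodule.sum_mem _ fun i _ => ?_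
    by_cases hi : i = .inl 1
    · simp [hi, h1]
    by_cases hi' : i = .inl 2
    · simp [hi', h2]
    refine Submodule.smul_mem _ _ (Submodule.subset_span ⟨i, hi, hi', ?_⟩)
    ext j
    simp [bas, Pi.single_apply, eq_comm]

set_option maxHeartbeats 1000000 in
theorem cb_mem_nilSpan (n : ℕ) (lam mu : ℝ) (i j : LieBas n) :
    cb n lam mu i j ∈ nilSpan n := by
  rw [mem_nilSpan_iff]
  rcases i with i | ⟨a, i⟩ <;> rcases j with j | ⟨b, j⟩ <;> fin_cases i <;> fin_cases j <;>
    simp [cb, Bv, bas] <;> split_ifs <;> simp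

theorem br_mem_nilSpan (n : ℕ) (lam mu : ℝ) (f g : LieG n) :
    br n lam mu f g ∈ nilSpan n :=
  Submodule.sum_mem _ fun i _ => Submodule.sum_mem _ fun j _ =>
    Submodule.smul_mem _ _ (cb_mem_nilSpan n lam mu i j)

theorem cb_mem_span_Bv (n : ℕ) (lam mu : ℝ) {i j : LieBas n}
    (hi1 : i ≠ .inl 1) (hi2 : i ≠ .inl 2) (hj1 : j ≠ .inl 1) (hj2 : j ≠ .inl 2) :
    cb n lam mu i j ∈ Submodule.span ℝ {Bv n} := by
  have hB := Submodule.mem_span_singleton_self (R := ℝ) (Bv n)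
  rcases i with i | ⟨a, i⟩ <;> rcases j with j | ⟨b, j⟩ <;> fin_cases i <;> fin_cases j <;>
    simp [cb] at hi1 hi2 hj1 hj2 ⊢ <;> split_ifs <;>
    simp [Submodule.smul_mem _ _ hB]

theorem br_mem_span_Bv {n : ℕ} (lam mu : ℝ) {u v : LieG n}
    (hu : u ∈ nilSpan n) (hv : v ∈ nilSpan n) :
    br n lam mu u v ∈ Submodule.span ℝ {Bv n} := by
  rw [mem_nilSpan_iff] at hu hv
  refine Submodule.sum_mem _ fun i _ => Submodule.sum_mem _ fun j _ => ?_
  by_cases hi1 : i = .inl 1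
  · simp [hi1, hu.1]
  by_cases hi2 : i = .inl 2
  · simp [hi2, hu.2]
  by_cases hj1 : j = .inl 1
  · simp [hj1, hv.1]
  by_cases hj2 : j = .inl 2
  · simp [hj2, hv.2]
  exact Submodule.smul_mem _ _ (cb_mem_span_Bv n lam mu hi1 hi2 hj1 hj2)

theorem br_smul_Bv_eq_zero {n : ℕ} (lam mu c : ℝ) {u : LieG n} (hu : u ∈ nilSpan n) :
    br n lam mu u (c • Bv n) = 0 := by
  rw [mem_nilSpan_iff] at hu
  refine Finset.sum_eq_zero fun i _ => Finset.sum_eq_zero fun j _ => ?_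
  rcases i with i | ⟨a, i⟩ <;> rcases j with j | ⟨b, j⟩ <;> fin_cases i <;> fin_cases j <;>
    simp [cb, Bv, bas, hu.1, hu.2]

theorem finrank_quotient_nilSpan (n : ℕ) : Module.finrank ℝ (LieG n ⧸ nilSpan n) = 2 := by
  let p : LieG n →ₗ[ℝ] ℝ × ℝ :=
    (LinearMap.proj (.inl 1)).prod (LinearMap.proj (.inl 2))
  have hker : nilSpan n = LinearMap.ker p := by
    ext v
    simp [mem_nilSpan_iff, p]
  have hsurj : Function.Surjective p := fun x =>
    ⟨x.1 • bas n (.inl 1) + x.2 • bas n (.inl 2), by ext <;> simp [p, bas]⟩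
  rw [hker, (p.quotKerEquivOfSurjective hsurj).finrank_eq]
  simp

/-- 𝔫 is an ideal of 𝔤, nilpotent of class at most 2 (with [𝔫,𝔫] ⊆ ℝB and
[𝔫,[𝔫,𝔫]] = 0), and the quotient 𝔤/𝔫 is abelian of dimension 2. -/
theorem nilradical_of_g (n : ℕ) (lam mu : ℝ) :
    (∀ f : LieG n, ∀ v ∈ nilSpan n, br n lam mu f v ∈ nilSpan n) ∧
    (∀ u ∈ nilSpan n, ∀ v ∈ nilSpan n,
      br n lam mu u v ∈ Submodule.span ℝ {Bv n}) ∧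
    (∀ u ∈ nilSpan n, ∀ v ∈ nilSpan n, ∀ w ∈ nilSpan n,
      br n lam mu u (br n lam mu v w) = 0) ∧
    (∀ f g : LieG n, br n lam mu f g ∈ nilSpan n) ∧
    Module.finrank ℝ (LieG n ⧸ nilSpan n) = 2 := by
  exact ⟨fun f v _ => br_mem_nilSpan n lam mu f v, fun u hu v hv => br_mem_span_Bv lam mu hu hv,
    fun u hu v hv w hw => by
      obtain ⟨c, hc⟩ := Submodule.mem_span_singleton.mp (br_mem_span_Bv lam mu hv hw)
      rw [← hc, br_smul_Bv_eq_zero lam mu c hu],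
    br_mem_nilSpan n lam mu, finrank_quotient_nilSpan n⟩
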